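/- Let L be a hitomezashi loop. If a is a longitude at which L has at least one horizontal stitch, then the horizontal stitches of L at longitude a are either all indents, all outdents, or all nondents of L. The analogous statement holds for the vertical stitches of L at a fixed latitude. -/

import Mathlib

/-- A stitch is a unit segment of the grid: `vert i j` is the vertical segment from
`(i,j)` to `(i,j+1)`; `horiz i j` is the horizontal segment from `(i,j)` to `(i+1,j)`. -/
inductive Stitch : Type
  | vert : ℤ → ℤ → Stitch
  | horiz : ℤ → ℤ → Stitch
  deriving DecidableEq

/-- Membership of a stitch in the hitomezashi pattern with labels `ε` (vertical lines)
and `η` (horizontal lines). -/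
def Stitch.InPattern (ε η : ℤ → ZMod 2) : Stitch → Prop
  | .vert i j => (j : ZMod 2) = ε i
  | .horiz i j => (i : ZMod 2) = η j

/-- The stitch as a subset of the plane. -/
def Stitch.seg : Stitch → Set (ℝ × ℝ)
  | .vert i j => segment ℝ ((i : ℝ), (j : ℝ)) ((i : ℝ), (j : ℝ) + 1)
  | .horiz i j => segment ℝ ((i : ℝ), (j : ℝ)) ((i : ℝ) + 1, (j : ℝ))

/-- The union of the segments of a set of stitches. -/
def curveOf (S : Set Stitch) : Set (ℝ × ℝ) := ⋃ s ∈ S, s.seg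

/-- `C` is a simple closed curve: it is homeomorphic to a circle. -/
def IsCircle (C : Set (ℝ × ℝ)) : Prop :=
  Nonempty (C ≃ₜ Metric.sphere (0 : ℝ × ℝ) 1)

/-- The interior of a closed curve `C`: the union of the bounded connected
components of its complement. -/
def intOf (C : Set (ℝ × ℝ)) : Set (ℝ × ℝ) :=
  {p | p ∉ C ∧ Bornology.IsBounded (connectedComponentIn Cᶜ p)}

/-- The exterior of a closed curve `C`: the union of the unbounded connected
components of its complement. -/
def extOf (C : Set (ℝ × ℝ)) : Set (ℝ × ℝ) :=
  {p | p ∉ C ∧ ¬ Bornology.IsBounded (connectedComponentIn Cᶜ p)}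

/-- The open unit cell with southwest corner `(i,j)`. -/
def cell (i j : ℤ) : Set (ℝ × ℝ) :=
  Set.Ioo (i : ℝ) ((i : ℝ) + 1) ×ˢ Set.Ioo (j : ℝ) ((j : ℝ) + 1)

/-- A hitomezashi loop in the pattern with labels `ε`, `η`: a (finite) set of stitches
of the pattern whose union is a simple closed curve. -/
structure HLoop (ε η : ℤ → ZMod 2) where
  stitches : Finset Stitch
  inPattern : ∀ s ∈ stitches, s.InPattern ε η
  isCircle : IsCircle (curveOf ↑stitches)

/-- The horizontal stitch `horiz i j` is an indent of `L`: the two vertical stitches of `L`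
adjacent to it have the same latitude and the unit cell between them lies in the exterior. -/
def IndentH {ε η : ℤ → ZMod 2} (L : HLoop ε η) (i j : ℤ) : Prop :=
  Stitch.horiz i j ∈ L.stitches ∧ ∃ j' : ℤ, (j' = j ∨ j' = j - 1) ∧
    Stitch.vert i j' ∈ L.stitches ∧ Stitch.vert (i+1) j' ∈ L.stitches ∧
    cell i j' ⊆ extOf (curveOf ↑L.stitches)

/-- The horizontal stitch `horiz i j` is an outdent of `L`. -/
def OutdentH {ε η : ℤ → ZMod 2} (L : HLoop ε η) (i j : ℤ) : Prop :=
  Stitch.horiz i j ∈ L.stitches ∧ ∃ j' : ℤ, (j' = j ∨ j' = j - 1) ∧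
    Stitch.vert i j' ∈ L.stitches ∧ Stitch.vert (i+1) j' ∈ L.stitches ∧
    cell i j' ⊆ intOf (curveOf ↑L.stitches)

/-- The horizontal stitch `horiz i j` is a nondent of `L`: the two adjacent vertical
stitches have different latitudes. -/
def NondentH {ε η : ℤ → ZMod 2} (L : HLoop ε η) (i j : ℤ) : Prop :=
  Stitch.horiz i j ∈ L.stitches ∧ ∃ j1 j2 : ℤ, (j1 = j ∨ j1 = j - 1) ∧ (j2 = j ∨ j2 = j - 1) ∧
    j1 ≠ j2 ∧ Stitch.vert i j1 ∈ L.stitches ∧ Stitch.vert (i+1) j2 ∈ L.stitches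

/-- The vertical stitch `vert i j` is an indent of `L`. -/
def IndentV {ε η : ℤ → ZMod 2} (L : HLoop ε η) (i j : ℤ) : Prop :=
  Stitch.vert i j ∈ L.stitches ∧ ∃ i' : ℤ, (i' = i ∨ i' = i - 1) ∧
    Stitch.horiz i' j ∈ L.stitches ∧ Stitch.horiz i' (j+1) ∈ L.stitches ∧
    cell i' j ⊆ extOf (curveOf ↑L.stitches)

/-- The vertical stitch `vert i j` is an outdent of `L`. -/
def OutdentV {ε η : ℤ → ZMod 2} (L : HLoop ε η) (i j : ℤ) : Prop :=
  Stitch.vert i j ∈ L.stitches ∧ ∃ i' : ℤ, (i' = i ∨ i' = i - 1) ∧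
    Stitch.horiz i' j ∈ L.stitches ∧ Stitch.horiz i' (j+1) ∈ L.stitches ∧
    cell i' j ⊆ intOf (curveOf ↑L.stitches)

/-- The vertical stitch `vert i j` is a nondent of `L`. -/
def NondentV {ε η : ℤ → ZMod 2} (L : HLoop ε η) (i j : ℤ) : Prop :=
  Stitch.vert i j ∈ L.stitches ∧ ∃ i1 i2 : ℤ, (i1 = i ∨ i1 = i - 1) ∧ (i2 = i ∨ i2 = i - 1) ∧
    i1 ≠ i2 ∧ Stitch.horiz i1 j ∈ L.stitches ∧ Stitch.horiz i2 (j+1) ∈ L.stitches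

open Set

/-- The lattice point `(a,b)` is an endpoint of the stitch. -/
def Stitch.Touches : Stitch → ℤ → ℤ → Prop
  | .vert i j, a, b => a = i ∧ (b = j ∨ b = j + 1)
  | .horiz i j, a, b => b = j ∧ (a = i ∨ a = i + 1)

theorem mem_seg_vert {i j : ℤ} {x : ℝ × ℝ} :
    x ∈ (Stitch.vert i j).seg ↔ x.1 = i ∧ (j : ℝ) ≤ x.2 ∧ x.2 ≤ j + 1 := by
  rcases x with ⟨x, y⟩
  simp only [Stitch.seg]
  rw [← Prod.image_mk_segment_right, segment_eq_Icc (by linarith)]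
  simp only [mem_image, mem_Icc, Prod.mk.injEq]
  constructor
  · rintro ⟨z, hz, rfl, rfl⟩
    exact ⟨rfl, hz⟩
  · rintro ⟨rfl, h⟩
    exact ⟨y, h, rfl, rfl⟩

theorem mem_seg_horiz {i j : ℤ} {x : ℝ × ℝ} :
    x ∈ (Stitch.horiz i j).seg ↔ x.2 = j ∧ (i : ℝ) ≤ x.1 ∧ x.1 ≤ i + 1 := by
  rcases x with ⟨x, y⟩
  simp only [Stitch.seg]
  rw [← Prod.image_mk_segment_left, segment_eq_Icc (by linarith)]
  simp only [mem_image, mem_Icc, Prod.mk.injEq]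
  constructor
  · rintro ⟨z, hz, rfl, rfl⟩
    exact ⟨rfl, hz⟩
  · rintro ⟨rfl, h⟩
    exact ⟨x, h, rfl, rfl⟩

theorem eq_or_eq_add_one_of_mem_Icc {a i : ℤ} (h₁ : (i : ℝ) ≤ a) (h₂ : (a : ℝ) ≤ i + 1) :
    a = i ∨ a = i + 1 := by
  have h₁ : i ≤ a := by exact_mod_cast h₁
  have h₂ : a ≤ i + 1 := by exact_mod_cast h₂
  omega

theorem exists_int_of_mem_Icc_of_mem_Icc {i j : ℤ} {y : ℝ} (hij : i ≠ j) (hi₁ : (i : ℝ) ≤ y)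
    (hi₂ : y ≤ i + 1) (hj₁ : (j : ℝ) ≤ y) (hj₂ : y ≤ j + 1) :
    ∃ b : ℤ, y = b ∧ (b = i ∨ b = i + 1) ∧ (b = j ∨ b = j + 1) := by
  have h₁ : i ≤ j + 1 := by exact_mod_cast hi₁.trans hj₂
  have h₂ : j ≤ i + 1 := by exact_mod_cast hj₁.trans hi₂
  rcases lt_or_gt_of_ne hij with h | h
  · obtain rfl : j = i + 1 := by omega
    push_cast at *
    exact ⟨i + 1, by push_cast; linarith, by omega, by omega⟩
  · obtain rfl : i = j + 1 := by omega
    push_cast at *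
    exact ⟨j + 1, by push_cast; linarith, by omega, by omega⟩

/-- Two distinct stitches can only meet at a common endpoint. -/
theorem exists_touches_of_mem_seg {s t : Stitch} (hst : s ≠ t) {x : ℝ × ℝ} (hs : x ∈ s.seg)
    (ht : x ∈ t.seg) :
    ∃ a b : ℤ, x = ((a : ℝ), (b : ℝ)) ∧ s.Touches a b ∧ t.Touches a b := by
  rcases x with ⟨x, y⟩
  rcases s with ⟨i, j⟩ | ⟨i, j⟩ <;> rcases t with ⟨k, l⟩ | ⟨k, l⟩ <;>
    simp only [mem_seg_vert, mem_seg_horiz] at hs ht <;>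
    obtain ⟨rfl, hs₁, hs₂⟩ := hs <;> obtain ⟨h, ht₁, ht₂⟩ := ht
  · obtain rfl : i = k := by exact_mod_cast h
    have hjl : j ≠ l := fun h => hst (by rw [h])
    obtain ⟨b, rfl, h₁, h₂⟩ := exists_int_of_mem_Icc_of_mem_Icc hjl hs₁ hs₂ ht₁ ht₂
    exact ⟨i, b, rfl, ⟨rfl, h₁⟩, ⟨rfl, h₂⟩⟩
  · subst h
    exact ⟨i, l, rfl, ⟨rfl, eq_or_eq_add_one_of_mem_Icc hs₁ hs₂⟩,
      ⟨rfl, eq_or_eq_add_one_of_mem_Icc ht₁ ht₂⟩⟩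
  · subst h
    exact ⟨k, j, rfl, ⟨rfl, eq_or_eq_add_one_of_mem_Icc hs₁ hs₂⟩,
      ⟨rfl, eq_or_eq_add_one_of_mem_Icc ht₁ ht₂⟩⟩
  · obtain rfl : j = l := by exact_mod_cast h
    have hik : i ≠ k := fun h => hst (by rw [h])
    obtain ⟨a, rfl, h₁, h₂⟩ := exists_int_of_mem_Icc_of_mem_Icc hik hs₁ hs₂ ht₁ ht₂
    exact ⟨a, j, rfl, ⟨rfl, h₁⟩, ⟨rfl, h₂⟩⟩

theorem Stitch.Touches.exists_other {s : Stitch} {a b : ℤ} (h : s.Touches a b) :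
    ∃ a' b' : ℤ, (a ≠ a' ∨ b ≠ b') ∧
      s.seg = segment ℝ ((a : ℝ), (b : ℝ)) ((a' : ℝ), (b' : ℝ)) ∧
      ∀ c d, s.Touches c d → (c = a ∧ d = b) ∨ (c = a' ∧ d = b') := by
  rcases s with ⟨i, j⟩ | ⟨i, j⟩ <;> obtain ⟨rfl, rfl | rfl⟩ := h <;>
    simp only [Stitch.Touches, Stitch.seg]
  · exact ⟨a, b + 1, by omega, by push_cast; rfl, by omega⟩
  · exact ⟨a, j, by omega, by rw [segment_symm]; push_cast; rfl, by omega⟩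
  · exact ⟨a + 1, b, by omega, by push_cast; rfl, by omega⟩
  · exact ⟨i, b, by omega, by rw [segment_symm]; push_cast; rfl, by omega⟩

theorem isClosed_seg (s : Stitch) : IsClosed s.seg := by
  have h (p q : ℝ × ℝ) : IsClosed (segment ℝ p q) := by
    rw [← convexHull_pair]
    exact (Set.toFinite {p, q}).isClosed_convexHull ℝ
  cases s <;> exact h _ _

theorem isClosed_curveOf {S : Set Stitch} (hS : S.Finite) : IsClosed (curveOf S) :=
  hS.isClosed_biUnion fun s _ => isClosed_seg s

theorem mem_curveOf {S : Set Stitch} {x : ℝ × ℝ} : x ∈ curveOf S ↔ ∃ s ∈ S, x ∈ s.seg := by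
  simp [curveOf]

theorem seg_nonempty (s : Stitch) : s.seg.Nonempty := by
  cases s <;> exact ⟨_, left_mem_segment ℝ _ _⟩

/-- A sphere with one point removed is connected. -/
theorem isPreconnected_sphere_diff_singleton {E : Type*} [NormedAddCommGroup E]
    [NormedSpace ℝ E] {v : E} (hv : ‖v‖ = 1) :
    IsPreconnected (Metric.sphere (0 : E) 1 \ {v}) := by
  have hv0 : v ≠ 0 := by
    rintro rfl
    simp at hv
  set U : Set E := {x | ∀ t : ℝ, 0 ≤ t → x ≠ t • v} with hU
  have hmem : -v ∈ U := by
    intro t ht h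
    have : (t + 1) • v = 0 := by rw [add_smul, ← h]; simp
    rcases smul_eq_zero.1 this with h' | h'
    · linarith
    · exact hv0 h'
  have hstar : StarConvex ℝ (-v) U := by
    intro x hx α β hα hβ hαβ t ht h
    rcases hβ.eq_or_lt with rfl | hβ
    · obtain rfl : α = 1 := by linarith
      exact hmem t ht (by simpa using h)
    · refine hx (β⁻¹ * (t + α)) (by positivity) ?_
      have h1 : β • x = (t + α) • v := by
        rw [add_smul, ← h]; simp
      rw [mul_smul, ← h1, smul_smul, inv_mul_cancel₀ hβ.ne', one_smul]
  have hUc : IsPreconnected U := (hstar.isPathConnected hmem).isConnected.isPreconnected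
  have hU0 : ∀ x ∈ U, ‖x‖ ≠ 0 := by
    intro x hx h
    exact hx 0 le_rfl (by simpa using h)
  have himg : (fun x : E => ‖x‖⁻¹ • x) '' U = Metric.sphere (0 : E) 1 \ {v} := by
    ext y
    constructor
    · rintro ⟨x, hx, rfl⟩
      have h0 := hU0 x hx
      refine ⟨by simp [norm_smul, h0], fun h => hx ‖x‖ (norm_nonneg x) ?_⟩
      rw [← mem_singleton_iff.1 h, smul_smul, mul_inv_cancel₀ h0, one_smul]
    · rintro ⟨hy, hyv⟩
      have hy : ‖y‖ = 1 := by simpa using hy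
      refine ⟨y, fun t ht h => hyv ?_, by simp [hy]⟩
      have : t = 1 := by
        have := congrArg norm h
        rw [hy, norm_smul, hv, Real.norm_eq_abs, abs_of_nonneg ht] at this
        linarith
      rw [h, this, one_smul]
      rfl
  rw [← himg]
  refine hUc.image _ (ContinuousOn.smul (continuous_norm.continuousOn.inv₀ hU0) continuousOn_id)

theorem IsCircle.isPreconnected_diff_singleton {C : Set (ℝ × ℝ)} (hC : IsCircle C) {m : ℝ × ℝ}
    (hm : m ∈ C) : IsPreconnected (C \ {m}) := by
  obtain ⟨e⟩ := hC
  have h1 := isPreconnected_sphere_diff_singleton (v := (e ⟨m, hm⟩ : ℝ × ℝ))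
    (mem_sphere_zero_iff_norm.1 (e ⟨m, hm⟩).2)
  have himg : (Subtype.val '' ({e ⟨m, hm⟩}ᶜ : Set (Metric.sphere (0 : ℝ × ℝ) 1))) =
      Metric.sphere (0 : ℝ × ℝ) 1 \ {(e ⟨m, hm⟩ : ℝ × ℝ)} := by
    rw [image_compl_eq_range_sdiff_image Subtype.val_injective, Subtype.range_coe,
      image_singleton]
  have h2 : IsPreconnected ({e ⟨m, hm⟩}ᶜ : Set (Metric.sphere (0 : ℝ × ℝ) 1)) := by
    rw [← Topology.IsInducing.subtypeVal.isPreconnected_image, himg]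
    exact h1
  convert h2.image (fun x => (e.symm x : ℝ × ℝ)) (by fun_prop) using 1
  ext x
  simp only [mem_image, mem_compl_iff, mem_singleton_iff, mem_sdiff]
  constructor
  · rintro ⟨hx, hne⟩
    refine ⟨e ⟨x, hx⟩, fun h => hne ?_, by simp⟩
    exact congrArg Subtype.val (e.injective h)
  · rintro ⟨y, hy, rfl⟩
    refine ⟨(e.symm y).2, fun h => hy ?_⟩
    have : e.symm y = ⟨m, hm⟩ := Subtype.ext h
    rw [← this, e.apply_symm_apply]

theorem IsCircle.isPreconnected {C : Set (ℝ × ℝ)} (hC : IsCircle C) : IsPreconnected C := by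
  obtain ⟨e⟩ := hC
  have h : IsPreconnected (Metric.sphere (0 : ℝ × ℝ) 1) :=
    isPreconnected_sphere (by
      rw [← Module.finrank_eq_rank]
      simp only [Module.finrank_prod, Module.finrank_self]
      norm_num) _ _
  have : PreconnectedSpace (Metric.sphere (0 : ℝ × ℝ) 1) := Subtype.preconnectedSpace h
  convert isPreconnected_range (f := fun x => (e.symm x : ℝ × ℝ)) (by fun_prop)
  rw [range_comp' Subtype.val e.symm, e.symm.surjective.range_eq, image_univ, Subtype.range_coe]

/-- A circle has no dangling segment. -/
theorem IsCircle.false_of_dangling {p q : ℝ × ℝ} (hpq : p ≠ q) {K : Set (ℝ × ℝ)}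
    (hK : IsClosed K) (hpqK : segment ℝ p q ∩ K ⊆ {q})
    (hC : IsCircle (segment ℝ p q ∪ K)) : False := by
  set f : ℝ → ℝ × ℝ := ⇑(AffineMap.lineMap p q : ℝ →ᵃ[ℝ] ℝ × ℝ) with hf
  have hinj : Function.Injective f := AffineMap.lineMap_injective ℝ hpq
  have hseg : segment ℝ p q = f '' Icc 0 1 := segment_eq_image_lineMap ℝ p q
  have hcl (a b : ℝ) : IsClosed (f '' Icc a b) :=
    (isCompact_Icc.image (by rw [hf]; exact AffineMap.lineMap_continuous)).isClosed
  have hq : f 1 = q := by simp [hf]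
  have hconn := hC.isPreconnected_diff_singleton (m := f (1 / 2))
    (Or.inl (hseg ▸ ⟨1 / 2, by constructor <;> norm_num, rfl⟩))
  rw [isPreconnected_closed_iff] at hconn
  obtain ⟨x, ⟨-, hxm⟩, ⟨t, ht, rfl⟩, hx⟩ :=
    hconn (f '' Icc 0 (1 / 2)) (f '' Icc (1 / 2) 1 ∪ K) (hcl _ _) ((hcl _ _).union hK) (by
      rintro x ⟨hx | hx, -⟩
      · rw [hseg] at hx
        obtain ⟨t, ht, rfl⟩ := hx
        rcases le_total t (1 / 2) with h | h
        · exact Or.inl ⟨t, ⟨ht.1, h⟩, rfl⟩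
        · exact Or.inr (Or.inl ⟨t, ⟨h, ht.2⟩, rfl⟩)
      · exact Or.inr (Or.inr hx))
    ⟨f 0, ⟨Or.inl (hseg ▸ ⟨0, by simp, rfl⟩), fun h => by
      have := hinj h; norm_num at this⟩, ⟨0, by simp, rfl⟩⟩
    ⟨f 1, ⟨Or.inl (hseg ▸ ⟨1, by simp, rfl⟩), fun h => by
      have := hinj h; norm_num at this⟩, Or.inl ⟨1, by constructor <;> norm_num, rfl⟩⟩
  rcases hx with ⟨u, hu, hut⟩ | hx
  · obtain rfl : u = t := hinj hut
    exact hxm (by rw [le_antisymm ht.2 hu.1]; rfl)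
  · have h1 : f t = q := hpqK ⟨hseg ▸ ⟨t, ⟨ht.1, by linarith [ht.2]⟩, rfl⟩, hx⟩
    have := hinj (h1.trans hq.symm)
    linarith [ht.2]

/-- Each endpoint of a stitch of a loop is an endpoint of another stitch of the loop. -/
theorem exists_ne_touches {S : Finset Stitch} (hS : IsCircle (curveOf ↑S)) {s : Stitch}
    (hs : s ∈ S) {a b : ℤ} (h : s.Touches a b) : ∃ t ∈ S, t ≠ s ∧ t.Touches a b := by
  by_contra! hcon
  obtain ⟨a', b', hne, hseg, hends⟩ := h.exists_other
  refine IsCircle.false_of_dangling (p := ((a : ℝ), (b : ℝ))) (q := ((a' : ℝ), (b' : ℝ)))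
    (K := curveOf ↑(S.erase s)) ?_ (isClosed_curveOf (Finset.finite_toSet _)) ?_ ?_
  · intro heq
    simp only [Prod.mk.injEq, Int.cast_inj] at heq
    omega
  · rintro x ⟨hx, hxK⟩
    rw [← hseg] at hx
    obtain ⟨t, ht, hxt⟩ := mem_curveOf.1 hxK
    obtain ⟨hts, htS⟩ := Finset.mem_erase.1 (Finset.mem_coe.1 ht)
    obtain ⟨c, d, rfl, hsc, htc⟩ := exists_touches_of_mem_seg hts.symm hx hxt
    rcases hends c d hsc with ⟨rfl, rfl⟩ | ⟨rfl, rfl⟩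
    · exact absurd htc (hcon t htS hts)
    · rfl
  · convert hS using 1
    rw [← hseg]
    conv_rhs => rw [← Finset.insert_erase hs]
    simp only [curveOf, Finset.coe_insert, biUnion_insert]

/-- A property of stitches that passes to adjacent stitches of a loop holds for all stitches of
the loop once it holds for one. -/
theorem forall_of_touches {S : Finset Stitch} (hS : IsCircle (curveOf ↑S)) (P : Stitch → Prop)
    (hP : ∀ s ∈ S, ∀ t ∈ S, s ≠ t → ∀ a b, s.Touches a b → t.Touches a b → P s → P t)
    {s t : Stitch} (hs : s ∈ S) (ht : t ∈ S) (h : P s) : P t := by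
  by_contra hPt
  have hconn := hS.isPreconnected
  rw [isPreconnected_closed_iff] at hconn
  obtain ⟨x, -, hx₁, hx₂⟩ := hconn (curveOf {u | u ∈ S ∧ P u}) (curveOf {u | u ∈ S ∧ ¬ P u})
    (isClosed_curveOf (S.finite_toSet.subset fun u hu => hu.1))
    (isClosed_curveOf (S.finite_toSet.subset fun u hu => hu.1))
    (by
      intro x hx
      obtain ⟨u, hu, hxu⟩ := mem_curveOf.1 hx
      by_cases hPu : P u
      · exact Or.inl (mem_curveOf.2 ⟨u, ⟨hu, hPu⟩, hxu⟩)
      · exact Or.inr (mem_curveOf.2 ⟨u, ⟨hu, hPu⟩, hxu⟩))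
    ((seg_nonempty s).mono fun x hx =>
      ⟨mem_curveOf.2 ⟨s, hs, hx⟩, mem_curveOf.2 ⟨s, ⟨hs, h⟩, hx⟩⟩)
    ((seg_nonempty t).mono fun x hx =>
      ⟨mem_curveOf.2 ⟨t, ht, hx⟩, mem_curveOf.2 ⟨t, ⟨ht, hPt⟩, hx⟩⟩)
  obtain ⟨u, ⟨hu, hPu⟩, hxu⟩ := mem_curveOf.1 hx₁
  obtain ⟨v, ⟨hv, hPv⟩, hxv⟩ := mem_curveOf.1 hx₂
  have huv : u ≠ v := by
    rintro rfl
    exact hPv hPu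
  obtain ⟨a, b, -, hua, hva⟩ := exists_touches_of_mem_seg huv hxu hxv
  exact hPv (hP u hu v hv huv a b hua hva hPu)

/-- The connected component of the complement of `curveOf S` containing the cell `cell i j`. -/
noncomputable def cellComponent (S : Finset Stitch) (i j : ℤ) : Set (ℝ × ℝ) :=
  connectedComponentIn (curveOf ↑S)ᶜ ((i : ℝ) + 1 / 2, (j : ℝ) + 1 / 2)

theorem connectedComponentIn_eq_of_convex {F U : Set (ℝ × ℝ)} (hU : Convex ℝ U) (hUF : U ⊆ F)
    {p q : ℝ × ℝ} (hp : p ∈ U) (hq : q ∈ U) :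
    connectedComponentIn F p = connectedComponentIn F q :=
  connectedComponentIn_eq (hU.isPreconnected.subset_connectedComponentIn hp hUF hq)

theorem int_false_of_mem_Ioo {a i : ℤ} (h₁ : (i : ℝ) < a) (h₂ : (a : ℝ) < i + 1) : False := by
  have h₁ : i < a := by exact_mod_cast h₁
  have h₂ : a < i + 1 := by exact_mod_cast h₂
  omega

theorem cell_subset_compl_curveOf (S : Set Stitch) (i j : ℤ) : cell i j ⊆ (curveOf S)ᶜ := by
  rintro ⟨x, y⟩ ⟨⟨hx₁, hx₂⟩, ⟨hy₁, hy₂⟩⟩ h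
  obtain ⟨s, -, hs⟩ := mem_curveOf.1 h
  rcases s with ⟨k, l⟩ | ⟨k, l⟩ <;> simp only [mem_seg_vert, mem_seg_horiz] at * <;>
    obtain ⟨rfl, -, -⟩ := hs
  · exact int_false_of_mem_Ioo hx₁ hx₂
  · exact int_false_of_mem_Ioo hy₁ hy₂

theorem connectedComponentIn_of_mem_cell {S : Finset Stitch} {i j : ℤ} {p : ℝ × ℝ}
    (hp : p ∈ cell i j) : connectedComponentIn (curveOf ↑S)ᶜ p = cellComponent S i j :=
  connectedComponentIn_eq_of_convex ((convex_Ioo _ _).prod (convex_Ioo _ _))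
    (cell_subset_compl_curveOf _ i j) hp
    ⟨⟨by simp, by simp; norm_num⟩, ⟨by simp, by simp; norm_num⟩⟩

theorem cell_subset_intOf {S : Finset Stitch} {i j : ℤ}
    (h : Bornology.IsBounded (cellComponent S i j)) : cell i j ⊆ intOf (curveOf ↑S) :=
  fun _ hp => ⟨cell_subset_compl_curveOf _ i j hp, by rwa [connectedComponentIn_of_mem_cell hp]⟩

theorem cell_subset_extOf {S : Finset Stitch} {i j : ℤ}
    (h : ¬ Bornology.IsBounded (cellComponent S i j)) : cell i j ⊆ extOf (curveOf ↑S) :=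
  fun _ hp => ⟨cell_subset_compl_curveOf _ i j hp, by rwa [connectedComponentIn_of_mem_cell hp]⟩

theorem int_eq_of_mem_Ioo_two {a i : ℤ} (h₁ : (i : ℝ) - 1 < a) (h₂ : (a : ℝ) < i + 1) :
    a = i := by
  have h₁ : i - 1 < a := by exact_mod_cast h₁
  have h₂ : a < i + 1 := by exact_mod_cast h₂
  omega

theorem int_eq_of_mem_Icc_of_mem_Ioo {b l : ℤ} {y : ℝ} (hb₁ : (b : ℝ) < y) (hb₂ : y < b + 1)
    (hl₁ : (l : ℝ) ≤ y) (hl₂ : y ≤ l + 1) : l = b := by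
  have h₁ : b < l + 1 := by exact_mod_cast hb₁.trans_le hl₂
  have h₂ : l < b + 1 := by exact_mod_cast hl₁.trans_lt hb₂
  omega

theorem cellComponent_sub_one_left {S : Finset Stitch} {a b : ℤ} (h : Stitch.vert a b ∉ S) :
    cellComponent S (a - 1) b = cellComponent S a b := by
  refine connectedComponentIn_eq_of_convex
    (U := Ioo ((a : ℝ) - 1) (a + 1) ×ˢ Ioo (b : ℝ) (b + 1))
    ((convex_Ioo _ _).prod (convex_Ioo _ _)) ?_ ?_ ?_
  · rintro ⟨x, y⟩ ⟨⟨hx₁, hx₂⟩, ⟨hy₁, hy₂⟩⟩ hxy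
    obtain ⟨s, hs, hxs⟩ := mem_curveOf.1 hxy
    rcases s with ⟨k, l⟩ | ⟨k, l⟩ <;> simp only [mem_seg_vert, mem_seg_horiz] at * <;>
      obtain ⟨rfl, hl₁, hl₂⟩ := hxs
    · obtain rfl := int_eq_of_mem_Ioo_two hx₁ hx₂
      obtain rfl := int_eq_of_mem_Icc_of_mem_Ioo hy₁ hy₂ hl₁ hl₂
      exact h hs
    · exact int_false_of_mem_Ioo hy₁ hy₂
  · push_cast
    refine ⟨⟨?_, ?_⟩, ?_, ?_⟩ <;> dsimp only <;> linarith
  · refine ⟨⟨?_, ?_⟩, ?_, ?_⟩ <;> dsimp only <;> linarith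

theorem cellComponent_sub_one_right {S : Finset Stitch} {a b : ℤ} (h : Stitch.horiz a b ∉ S) :
    cellComponent S a (b - 1) = cellComponent S a b := by
  refine connectedComponentIn_eq_of_convex
    (U := Ioo (a : ℝ) (a + 1) ×ˢ Ioo ((b : ℝ) - 1) (b + 1))
    ((convex_Ioo _ _).prod (convex_Ioo _ _)) ?_ ?_ ?_
  · rintro ⟨x, y⟩ ⟨⟨hx₁, hx₂⟩, ⟨hy₁, hy₂⟩⟩ hxy
    obtain ⟨s, hs, hxs⟩ := mem_curveOf.1 hxy
    rcases s with ⟨k, l⟩ | ⟨k, l⟩ <;> simp only [mem_seg_vert, mem_seg_horiz] at * <;>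
      obtain ⟨rfl, hl₁, hl₂⟩ := hxs
    · exact int_false_of_mem_Ioo hx₁ hx₂
    · obtain rfl := int_eq_of_mem_Ioo_two hy₁ hy₂
      obtain rfl := int_eq_of_mem_Icc_of_mem_Ioo hx₁ hx₂ hl₁ hl₂
      exact h hs
  · push_cast
    refine ⟨⟨?_, ?_⟩, ?_, ?_⟩ <;> dsimp only <;> linarith
  · refine ⟨⟨?_, ?_⟩, ?_, ?_⟩ <;> dsimp only <;> linarith

/-- The component containing the cell `cell i j` adjacent to a given stitch for which
`i + j` has parity `k`. -/
noncomputable def sideComponent (S : Finset Stitch) (k : ZMod 2) : Stitch → Set (ℝ × ℝ)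
  | .vert i j => if (i + j : ZMod 2) = k then cellComponent S i j else cellComponent S (i - 1) j
  | .horiz i j => if (i + j : ZMod 2) = k then cellComponent S i j else cellComponent S i (j - 1)

theorem ZMod.ne_sub_one_two (x : ZMod 2) : x ≠ x - 1 := by
  revert x; decide

theorem vert_sub_one_notMem {ε η : ℤ → ZMod 2} {S : Finset Stitch}
    (hpat : ∀ s ∈ S, s.InPattern ε η) {a b : ℤ} (h : Stitch.vert a b ∈ S) :
    Stitch.vert a (b - 1) ∉ S := by
  intro h'
  have h₁ : (b : ZMod 2) = ε a := hpat _ h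
  have h₂ : ((b - 1 : ℤ) : ZMod 2) = ε a := hpat _ h'
  push_cast at h₂
  exact ZMod.ne_sub_one_two (b : ZMod 2) (h₁.trans h₂.symm)

theorem horiz_sub_one_notMem {ε η : ℤ → ZMod 2} {S : Finset Stitch}
    (hpat : ∀ s ∈ S, s.InPattern ε η) {a b : ℤ} (h : Stitch.horiz a b ∈ S) :
    Stitch.horiz (a - 1) b ∉ S := by
  intro h'
  have h₁ : (a : ZMod 2) = η b := hpat _ h
  have h₂ : ((a - 1 : ℤ) : ZMod 2) = η b := hpat _ h'
  push_cast at h₂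
  exact ZMod.ne_sub_one_two (a : ZMod 2) (h₁.trans h₂.symm)

theorem vert_add_one_notMem {ε η : ℤ → ZMod 2} {S : Finset Stitch}
    (hpat : ∀ s ∈ S, s.InPattern ε η) {a b : ℤ} (h : Stitch.vert a b ∈ S) :
    Stitch.vert a (b + 1) ∉ S := fun h' =>
  vert_sub_one_notMem hpat h' (by rwa [add_sub_cancel_right])

theorem horiz_add_one_notMem {ε η : ℤ → ZMod 2} {S : Finset Stitch}
    (hpat : ∀ s ∈ S, s.InPattern ε η) {a b : ℤ} (h : Stitch.horiz a b ∈ S) :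
    Stitch.horiz (a + 1) b ∉ S := fun h' =>
  horiz_sub_one_notMem hpat h' (by rwa [add_sub_cancel_right])

theorem exists_vert_of_horiz_touches {ε η : ℤ → ZMod 2} {S : Finset Stitch}
    (hpat : ∀ s ∈ S, s.InPattern ε η) (hS : IsCircle (curveOf ↑S)) {i j a : ℤ}
    (h : Stitch.horiz i j ∈ S) (ha : a = i ∨ a = i + 1) :
    ∃ j', (j' = j ∨ j' = j - 1) ∧ Stitch.vert a j' ∈ S := by
  obtain ⟨t, ht, hne, htouch⟩ := exists_ne_touches hS h (a := a) (b := j) ⟨rfl, ha⟩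
  rcases t with ⟨k, l⟩ | ⟨k, l⟩ <;> obtain ⟨rfl, hl⟩ := htouch
  · exact ⟨l, by omega, ht⟩
  · have hki : k ≠ i := fun h => hne (by rw [h])
    rcases (by omega : k = i - 1 ∨ i = k - 1) with rfl | rfl
    · exact absurd ht (horiz_sub_one_notMem hpat h)
    · exact absurd h (horiz_sub_one_notMem hpat ht)

theorem exists_horiz_of_vert_touches {ε η : ℤ → ZMod 2} {S : Finset Stitch}
    (hpat : ∀ s ∈ S, s.InPattern ε η) (hS : IsCircle (curveOf ↑S)) {i j b : ℤ}
    (h : Stitch.vert i j ∈ S) (hb : b = j ∨ b = j + 1) :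
    ∃ i', (i' = i ∨ i' = i - 1) ∧ Stitch.horiz i' b ∈ S := by
  obtain ⟨t, ht, hne, htouch⟩ := exists_ne_touches hS h (a := i) (b := b) ⟨rfl, hb⟩
  rcases t with ⟨k, l⟩ | ⟨k, l⟩ <;> obtain ⟨rfl, hl⟩ := htouch
  · have hlj : l ≠ j := fun h => hne (by rw [h])
    rcases (by omega : l = j - 1 ∨ j = l - 1) with rfl | rfl
    · exact absurd ht (vert_sub_one_notMem hpat h)
    · exact absurd h (vert_sub_one_notMem hpat ht)
  · exact ⟨k, by omega, ht⟩

theorem sideComponent_horiz_eq_vert {ε η : ℤ → ZMod 2} {S : Finset Stitch}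
    (hpat : ∀ s ∈ S, s.InPattern ε η) (k : ZMod 2) {a b i j : ℤ} (hi : a = i ∨ a = i + 1)
    (hj : b = j ∨ b = j + 1) (hh : Stitch.horiz i b ∈ S) (hv : Stitch.vert a j ∈ S) :
    sideComponent S k (.horiz i b) = sideComponent S k (.vert a j) := by
  have key (x : ZMod 2) : x + 1 = k ↔ ¬ x = k := by revert x k; decide
  simp only [sideComponent]
  rcases hi with rfl | rfl <;> rcases hj with rfl | rfl
  · have h₁ := cellComponent_sub_one_right (horiz_sub_one_notMem hpat hh)
    have h₂ := cellComponent_sub_one_left (vert_sub_one_notMem hpat hv)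
    rw [← h₁, h₂]
  · have h₁ := cellComponent_sub_one_right (horiz_sub_one_notMem hpat hh)
    have h₂ := cellComponent_sub_one_left (vert_add_one_notMem hpat hv)
    rw [add_sub_cancel_right] at h₁ ⊢
    push_cast
    rw [← add_assoc]
    simp only [key, ite_not, h₁, h₂]
  · have h₁ := cellComponent_sub_one_right (horiz_add_one_notMem hpat hh)
    have h₂ := cellComponent_sub_one_left (vert_sub_one_notMem hpat hv)
    rw [add_sub_cancel_right] at h₂ ⊢
    push_cast
    rw [add_right_comm]
    simp only [key, ite_not, h₁, h₂]
  · have h₁ := cellComponent_sub_one_right (horiz_add_one_notMem hpat hh)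
    have h₂ := cellComponent_sub_one_left (vert_add_one_notMem hpat hv)
    rw [add_sub_cancel_right] at h₁ h₂ ⊢
    rw [add_sub_cancel_right]
    push_cast
    rw [← add_assoc, add_right_comm]
    simp only [h₁, h₂]

theorem sideComponent_eq {ε η : ℤ → ZMod 2} {S : Finset Stitch}
    (hpat : ∀ s ∈ S, s.InPattern ε η) (hS : IsCircle (curveOf ↑S)) (k : ZMod 2) {s t : Stitch}
    (hs : s ∈ S) (ht : t ∈ S) : sideComponent S k s = sideComponent S k t := by
  refine forall_of_touches hS (fun u => sideComponent S k s = sideComponent S k u) ?_ hs ht rfl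
  intro u hu v hv huv a b hua hva h
  refine h.trans ?_
  rcases u with ⟨i, j⟩ | ⟨i, j⟩ <;> rcases v with ⟨i', j'⟩ | ⟨i', j'⟩ <;>
    obtain ⟨rfl, h₁⟩ := hua <;> obtain ⟨rfl, h₂⟩ := hva
  · have hne : j ≠ j' := fun h => huv (by rw [h])
    rcases (by omega : j = j' - 1 ∨ j' = j - 1) with rfl | rfl
    · exact absurd hu (vert_sub_one_notMem hpat hv)
    · exact absurd hv (vert_sub_one_notMem hpat hu)
  · exact (sideComponent_horiz_eq_vert hpat k h₂ h₁ hv hu).symm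
  · exact sideComponent_horiz_eq_vert hpat k h₁ h₂ hu hv
  · have hne : i ≠ i' := fun h => huv (by rw [h])
    rcases (by omega : i = i' - 1 ∨ i' = i - 1) with rfl | rfl
    · exact absurd hu (horiz_sub_one_notMem hpat hv)
    · exact absurd hv (horiz_sub_one_notMem hpat hu)

theorem eq_of_cast_zmod_two_eq {a b c : ℤ} (ha : a = c ∨ a = c - 1) (hb : b = c ∨ b = c - 1)
    (h : (a : ZMod 2) = b) : a = b := by
  have := (ZMod.intCast_eq_intCast_iff_dvd_sub a b 2).1 h
  omega

theorem dent_classification_horiz {ε η : ℤ → ZMod 2} (L : HLoop ε η) (i : ℤ) :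
    (∀ j, Stitch.horiz i j ∈ L.stitches → IndentH L i j) ∨
      (∀ j, Stitch.horiz i j ∈ L.stitches → OutdentH L i j) ∨
      (∀ j, Stitch.horiz i j ∈ L.stitches → NondentH L i j) := by
  by_cases hε : ε i = ε (i + 1)
  · have key (j : ℤ) (h : Stitch.horiz i j ∈ L.stitches) :
        ∃ j', (j' = j ∨ j' = j - 1) ∧ Stitch.vert i j' ∈ L.stitches ∧
          Stitch.vert (i + 1) j' ∈ L.stitches ∧ cellComponent L.stitches i j' =
            sideComponent L.stitches (i + ε i) (.vert i j') := by
      obtain ⟨j₁, hj₁, h₁⟩ :=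
        exists_vert_of_horiz_touches L.inPattern L.isCircle h (Or.inl rfl)
      obtain ⟨j₂, hj₂, h₂⟩ :=
        exists_vert_of_horiz_touches L.inPattern L.isCircle h (Or.inr rfl)
      have e₁ : (j₁ : ZMod 2) = ε i := L.inPattern _ h₁
      have e₂ : (j₂ : ZMod 2) = ε (i + 1) := L.inPattern _ h₂
      obtain rfl := eq_of_cast_zmod_two_eq hj₁ hj₂ (by rw [e₁, e₂, hε])
      exact ⟨j₁, hj₁, h₁, h₂, by simp [sideComponent, e₁]⟩
    by_cases hb : ∃ j, Stitch.vert i j ∈ L.stitches ∧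
        Bornology.IsBounded (sideComponent L.stitches (i + ε i) (.vert i j))
    · obtain ⟨j₀, hj₀, hb⟩ := hb
      refine Or.inr (Or.inl fun j hj => ?_)
      obtain ⟨j', hj', h₁, h₂, h₃⟩ := key j hj
      refine ⟨hj, j', hj', h₁, h₂, cell_subset_intOf ?_⟩
      rwa [h₃, sideComponent_eq L.inPattern L.isCircle _ h₁ hj₀]
    · refine Or.inl fun j hj => ?_
      obtain ⟨j', hj', h₁, h₂, h₃⟩ := key j hj
      exact ⟨hj, j', hj', h₁, h₂, cell_subset_extOf fun h => hb ⟨j', h₁, h₃ ▸ h⟩⟩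
  · refine Or.inr (Or.inr fun j h => ?_)
    obtain ⟨j₁, hj₁, h₁⟩ := exists_vert_of_horiz_touches L.inPattern L.isCircle h (Or.inl rfl)
    obtain ⟨j₂, hj₂, h₂⟩ := exists_vert_of_horiz_touches L.inPattern L.isCircle h (Or.inr rfl)
    refine ⟨h, j₁, j₂, hj₁, hj₂, ?_, h₁, h₂⟩
    rintro rfl
    exact hε ((L.inPattern _ h₁).symm.trans (L.inPattern _ h₂))

theorem dent_classification_vert {ε η : ℤ → ZMod 2} (L : HLoop ε η) (j : ℤ) :
    (∀ i, Stitch.vert i j ∈ L.stitches → IndentV L i j) ∨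
      (∀ i, Stitch.vert i j ∈ L.stitches → OutdentV L i j) ∨
      (∀ i, Stitch.vert i j ∈ L.stitches → NondentV L i j) := by
  by_cases hη : η j = η (j + 1)
  · have key (i : ℤ) (h : Stitch.vert i j ∈ L.stitches) :
        ∃ i', (i' = i ∨ i' = i - 1) ∧ Stitch.horiz i' j ∈ L.stitches ∧
          Stitch.horiz i' (j + 1) ∈ L.stitches ∧ cellComponent L.stitches i' j =
            sideComponent L.stitches (η j + j) (.horiz i' j) := by
      obtain ⟨i₁, hi₁, h₁⟩ :=
        exists_horiz_of_vert_touches L.inPattern L.isCircle h (Or.inl rfl)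
      obtain ⟨i₂, hi₂, h₂⟩ :=
        exists_horiz_of_vert_touches L.inPattern L.isCircle h (Or.inr rfl)
      have e₁ : (i₁ : ZMod 2) = η j := L.inPattern _ h₁
      have e₂ : (i₂ : ZMod 2) = η (j + 1) := L.inPattern _ h₂
      obtain rfl := eq_of_cast_zmod_two_eq hi₁ hi₂ (by rw [e₁, e₂, hη])
      exact ⟨i₁, hi₁, h₁, h₂, by simp [sideComponent, e₁]⟩
    by_cases hb : ∃ i, Stitch.horiz i j ∈ L.stitches ∧
        Bornology.IsBounded (sideComponent L.stitches (η j + j) (.horiz i j))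
    · obtain ⟨i₀, hi₀, hb⟩ := hb
      refine Or.inr (Or.inl fun i hi => ?_)
      obtain ⟨i', hi', h₁, h₂, h₃⟩ := key i hi
      refine ⟨hi, i', hi', h₁, h₂, cell_subset_intOf ?_⟩
      rwa [h₃, sideComponent_eq L.inPattern L.isCircle _ h₁ hi₀]
    · refine Or.inl fun i hi => ?_
      obtain ⟨i', hi', h₁, h₂, h₃⟩ := key i hi
      exact ⟨hi, i', hi', h₁, h₂, cell_subset_extOf fun h => hb ⟨i', h₁, h₃ ▸ h⟩⟩
  · refine Or.inr (Or.inr fun i h => ?_)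
    obtain ⟨i₁, hi₁, h₁⟩ := exists_horiz_of_vert_touches L.inPattern L.isCircle h (Or.inl rfl)
    obtain ⟨i₂, hi₂, h₂⟩ := exists_horiz_of_vert_touches L.inPattern L.isCircle h (Or.inr rfl)
    refine ⟨h, i₁, i₂, hi₁, hi₂, ?_, h₁, h₂⟩
    rintro rfl
    exact hη ((L.inPattern _ h₁).symm.trans (L.inPattern _ h₂))

/-- For a hitomezashi loop `L`, at any longitude carrying horizontal
stitches of `L`, those stitches are either all indents, all outdents, or all nondents;
analogously for vertical stitches at a fixed latitude. -/
theorem hitomezashi_dent_classification (ε η : ℤ → ZMod 2) (L : HLoop ε η) :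
    (∀ i : ℤ, (∃ j, Stitch.horiz i j ∈ L.stitches) →
      ((∀ j, Stitch.horiz i j ∈ L.stitches → IndentH L i j) ∨
       (∀ j, Stitch.horiz i j ∈ L.stitches → OutdentH L i j) ∨
       (∀ j, Stitch.horiz i j ∈ L.stitches → NondentH L i j))) ∧
    (∀ j : ℤ, (∃ i, Stitch.vert i j ∈ L.stitches) →
      ((∀ i, Stitch.vert i j ∈ L.stitches → IndentV L i j) ∨
       (∀ i, Stitch.vert i j ∈ L.stitches → OutdentV L i j) ∨
       (∀ i, Stitch.vert i j ∈ L.stitches → NondentV L i j))) := by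
  exact ⟨fun i _ => dent_classification_horiz L i, fun j _ => dent_classification_vert L j⟩
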